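/- Let n = p^m be a prime power and let χ₁, …, χ_s all be the trivial (principal) Dirichlet character modulo p^m. Let 0 ≤ k ≤ m be an integer. Then ∑ gcd(a₁−1, …, a_s−1, p^k), where a₁, …, a_s range over integers in [1,p^m] coprime to p, equals φ(p^m)^s − φ(p^m)·p^{m(s−1)} + φ(p^m)·p^{(m−k)(s−1)}·σ_{s−1}(p^k). -/

import Mathlib

open Finset

lemma aux_gcd (p k g : ℕ) (hp : p.Prime) :
    (Nat.gcd g (p ^ k) : ℤ) =
      ∑ j ∈ range (k + 1), if p ^ j ∣ g then (Nat.totient (p ^ j) : ℤ) else 0 := by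
  have hpk : p ^ k ≠ 0 := pow_ne_zero _ hp.ne_zero
  have h1 : (Nat.gcd g (p ^ k)).divisors = (p ^ k).divisors.filter (fun d => d ∣ g) := by
    ext d
    simp only [Nat.mem_divisors, mem_filter, Nat.dvd_gcd_iff]
    have : Nat.gcd g (p ^ k) ≠ 0 := Nat.gcd_ne_zero_right hpk
    tauto
  have h2 := Nat.sum_totient (Nat.gcd g (p ^ k))
  rw [h1, sum_filter, Nat.divisors_prime_pow hp, sum_map] at h2
  rw [← h2]
  push_cast
  rfl

lemma aux_count (p m j : ℕ) (hp : p.Prime) (hj : 1 ≤ j) (hjm : j ≤ m) :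
    #(((Finset.Icc 1 (p ^ m)).filter fun x => Nat.Coprime x p).filter
      fun x => p ^ j ∣ x - 1) = p ^ (m - j) := by
  have hpos : 0 < p ^ j := pow_pos hp.pos _
  have hmm : p ^ m = p ^ j * p ^ (m - j) := by rw [← pow_add]; congr 1; omega
  have : ((Finset.Icc 1 (p ^ m)).filter fun x => Nat.Coprime x p).filter
      (fun x => p ^ j ∣ x - 1) = (range (p ^ (m - j))).image (fun t => p ^ j * t + 1) := by
    ext x
    simp only [mem_filter, mem_Icc, mem_image, mem_range]
    constructor
    · rintro ⟨⟨⟨h1, h2⟩, _⟩, t, ht⟩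
      refine ⟨t, ?_, by omega⟩
      have : p ^ j * t < p ^ j * p ^ (m - j) := by omega
      exact lt_of_mul_lt_mul_left this (Nat.zero_le _)
    · rintro ⟨t, ht, rfl⟩
      refine ⟨⟨⟨by omega, ?_⟩, ?_⟩, by simp⟩
      · have := Nat.mul_lt_mul_of_pos_left ht hpos
        omega
      · obtain ⟨i, rfl⟩ : ∃ i, j = i + 1 := ⟨j - 1, by omega⟩
        have : p ^ (i + 1) * t + 1 = 1 + (p ^ i * t) * p := by ring
        rw [this]
        simp
  rw [this, card_image_of_injective, card_range]
  intro a b h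
  have h' : p ^ j * a = p ^ j * b := by simpa using h
  exact Nat.eq_of_mul_eq_mul_left hpos h'

lemma aux_tot (p m : ℕ) (hm : 0 < m) :
    #((Finset.Icc 1 (p ^ m)).filter fun x => Nat.Coprime x p) = Nat.totient (p ^ m) := by
  rw [← Nat.filter_coprime_Ico_eq_totient (p ^ m) 1]
  congr 1
  ext x
  simp only [mem_filter, mem_Icc, mem_Ico, Nat.coprime_pow_left_iff hm, Nat.coprime_comm (m := x)]
  have : x ≤ p ^ m ↔ x < 1 + p ^ m := by omega
  rw [this]

/-- the gcd sum in the case where all characters are trivial. -/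
theorem gcd_sum_trivial_characters
    (p m s k : ℕ) (hp : p.Prime) (hm : 0 < m) (hs : 0 < s)
    (χ : Fin s → DirichletCharacter ℂ (p ^ m)) (hχ : ∀ i, χ i = 1)
    (hk : k ≤ m) :
    ∑ a ∈ Fintype.piFinset
        (fun _ : Fin s => (Finset.Icc 1 (p ^ m)).filter fun x => Nat.Coprime x p),
      (Nat.gcd (Finset.univ.gcd fun i => a i - 1) (p ^ k) : ℤ)
    = (Nat.totient (p ^ m) : ℤ) ^ s -
        (Nat.totient (p ^ m) : ℤ) * (p : ℤ) ^ (m * (s - 1)) +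
        (Nat.totient (p ^ m) : ℤ) * (p : ℤ) ^ ((m - k) * (s - 1)) *
          ∑ e ∈ (p ^ k).divisors, (e : ℤ) ^ (s - 1) := by
  have key : ∀ j, ∑ a ∈ Fintype.piFinset
        (fun _ : Fin s => (Finset.Icc 1 (p ^ m)).filter fun x => Nat.Coprime x p),
        (if p ^ j ∣ (Finset.univ.gcd fun i => a i - 1) then (Nat.totient (p ^ j) : ℤ) else 0)
      = (#(((Finset.Icc 1 (p ^ m)).filter fun x => Nat.Coprime x p).filter
      fun x => p ^ j ∣ x - 1) : ℤ) ^ s * Nat.totient (p ^ j) := by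
    intro j
    rw [← sum_filter, sum_const, nsmul_eq_mul]
    congr 1
    have : (Fintype.piFinset
        (fun _ : Fin s => (Finset.Icc 1 (p ^ m)).filter fun x => Nat.Coprime x p)).filter
        (fun a => p ^ j ∣ (Finset.univ.gcd fun i => a i - 1)) =
        Fintype.piFinset (fun _ : Fin s =>
          ((Finset.Icc 1 (p ^ m)).filter fun x => Nat.Coprime x p).filter
            fun x => p ^ j ∣ x - 1) := by
      ext a
      simp only [mem_filter, Fintype.mem_piFinset, Finset.dvd_gcd_iff, mem_univ, true_implies,
        forall_and]
    rw [this, Fintype.card_piFinset]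
    simp
  simp_rw [aux_gcd p k _ hp]
  rw [sum_comm]
  simp_rw [key]
  rw [sum_range_succ']
  obtain ⟨r, rfl⟩ : ∃ r, s = r + 1 := ⟨s - 1, by omega⟩
  have h0 := aux_tot p m hm
  simp only [pow_zero, one_dvd, filter_true, h0, Nat.totient_one, Nat.cast_one, mul_one,
    Nat.add_sub_cancel]
  have h1 : ∑ j ∈ range k, (#(((Finset.Icc 1 (p ^ m)).filter fun x => Nat.Coprime x p).filter
      fun x => p ^ (j + 1) ∣ x - 1) : ℤ) ^ (r + 1) * Nat.totient (p ^ (j + 1))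
      = ∑ j ∈ range k, (Nat.totient (p ^ m) : ℤ) * (p : ℤ) ^ ((m - (j + 1)) * r) := by
    refine sum_congr rfl fun j hj => ?_
    have hj' := mem_range.1 hj
    rw [aux_count p m (j + 1) hp (by omega) (by omega)]
    have : p ^ (m - (j + 1)) * Nat.totient (p ^ (j + 1)) = Nat.totient (p ^ m) := by
      rw [Nat.totient_prime_pow hp (by omega), Nat.totient_prime_pow hp hm, ← mul_assoc,
        ← pow_add]
      congr 2
      omega
    rw [← this]
    push_cast
    rw [pow_mul]
    ring
  rw [h1, Nat.sum_divisors_prime_pow hp, ← mul_sum]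
  have h2 : (p : ℤ) ^ ((m - k) * r) * ∑ i ∈ range (k + 1), ((p ^ i : ℕ) : ℤ) ^ r =
      ∑ j ∈ range (k + 1), (p : ℤ) ^ ((m - j) * r) := by
    rw [← sum_range_reflect (fun j => (p : ℤ) ^ ((m - j) * r)), mul_sum]
    refine sum_congr rfl fun i hi => ?_
    have hi' := mem_range.1 hi
    push_cast
    rw [← pow_mul, ← pow_add, ← add_mul]
    congr 2
    omega
  rw [mul_assoc, h2, sum_range_succ']
  simp only [Nat.sub_zero]
  ring
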